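/- Let 𝓜 = (Q, V, T₁, T₂, δ, q₀, q₁, Z_l, B, Z_r) be a deterministic linear bounded automaton and x = v₁v₂…v_n ∈ T₁* an input of length n. Let Π = (Ṽ, R) be the Boolean P system with alphabet Ṽ = { A_{v,j} | v ∈ V, 0 ≤ j ≤ n+1 } ∪ { C_{q,j} | q ∈ Q, 0 ≤ j ≤ n+1 } and rules R = ⋃_{ρ∈δ} R_ρ, where for each instruction ρ = (q, X; p, Y, D) of 𝓜: R_{(q,X;p,Y,R)} = { {A_{X,j}, C_{q,j}} → {A_{Y,j}, C_{p,j+1}} | ⊤ : 0 ≤ j ≤ n }, R_{(q,X;p,Y,S)} = { {A_{X,j}, C_{q,j}} → {A_{Y,j}, C_{p,j}} | ⊤ : 0 ≤ j ≤ n+1 }, and R_{(q,X;p,Y,L)} = { {A_{X,j}, C_{q,j}} → {A_{Y,j}, C_{p,j-1}} | ⊤ : 1 ≤ j ≤ n+1 }. Then 𝓜 accepts x if and only if Π, evolving under the quasimode M̃ = {R} from the initial configuration s_x = { A_{v_j,j} | 1 ≤ j ≤ n } ∪ { A_{Z_l,0}, A_{Z_r,n+1}, C_{q₀,1} }, can reach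 the configuration { A_{B,j} | 1 ≤ j ≤ n } ∪ { C_{q₁,0}, A_{Z_l,0}, A_{Z_r,n+1} }. -/

import Mathlib

/-- A rule `A → B | φ` of a Boolean P system: a left-hand side `A ⊆ V`,
a right-hand side `B ⊆ V`, and a guard `φ`, a predicate on subsets of `V`. -/
structure BRule (σ : Type*) where
  lhs : Set σ
  rhs : Set σ
  guard : Set σ → Prop

/-- A rule `A → B | φ` is applicable to a configuration `W` iff `A ⊆ W` and `φ(W)` holds. -/
def BRule.applicable {σ : Type*} (r : BRule σ) (W : Set σ) : Prop :=
  r.lhs ⊆ W ∧ r.guard W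

/-- `Appl R W` : the set of all subsets of the rule set `R` each of whose
rules is applicable to `W`. -/
def Appl {σ : Type*} (R : Set (BRule σ)) (W : Set σ) : Set (Set (BRule σ)) :=
  {m | m ⊆ R ∧ ∀ r ∈ m, r.applicable W}

/-- Applying a set of (individually applicable) rules `{Aᵢ → Bᵢ | φᵢ}` to `W`
yields `(W \ ⋃ᵢ Aᵢ) ∪ ⋃ᵢ Bᵢ`. -/
def applyRules {σ : Type*} (m : Set (BRule σ)) (W : Set σ) : Set σ :=
  (W \ ⋃ r ∈ m, BRule.lhs r) ∪ ⋃ r ∈ m, BRule.rhs r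

/-- Applying a set of rules to `W`, where exactly those rules of the set that
are applicable to `W` are applied. -/
def applyAppl {σ : Type*} (m : Set (BRule σ)) (W : Set σ) : Set σ :=
  applyRules {r ∈ m | r.applicable W} W

/-- `A ⊗ B = { a ∪ b | a ∈ A, b ∈ B }` for sets of sets. -/
def otimes {α : Type*} (A B : Set (Set α)) : Set (Set α) :=
  {c | ∃ a ∈ A, ∃ b ∈ B, c = a ∪ b}

/-- One evolution step of a Boolean P system under a quasimode `Mt`: choose a
set of rules `m ∈ Mt` and apply all of its rules applicable to the current
configuration. -/
def QStep {σ : Type*} (Mt : Set (Set (BRule σ))) (W W' : Set σ) : Prop :=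
  ∃ m ∈ Mt, W' = applyAppl m W

/-- Head movement directions of an LBA. -/
inductive Dir | L | R | S
deriving DecidableEq

/-- Position update: `L` moves left, `R` moves right, `S` stays. -/
def movePos : Dir → ℕ → ℕ
  | Dir.L, j => j - 1
  | Dir.R, j => j + 1
  | Dir.S, j => j

/-- A deterministic linear bounded automaton
`𝓜 = (Q, V, T₁, T₂, δ, q₀, q₁, Z_l, B, Z_r)`.  The transition function is
restricted so that the boundary markers are never overwritten or exceeded. -/
structure LBA (Q V : Type*) where
  T1 : Set V
  T2 : Set V
  δ : Q → V → Q × V × Dir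
  q0 : Q
  q1 : Q
  Zl : V
  B : V
  Zr : V
  hT1 : Zl ∉ T1 ∧ B ∉ T1 ∧ Zr ∉ T1
  hT2 : Zl ∉ T2 ∧ B ∉ T2 ∧ Zr ∉ T2
  hZl : ∀ q, (δ q Zl).2.1 = Zl ∧ (δ q Zl).2.2 ≠ Dir.L
  hZr : ∀ q, (δ q Zr).2.1 = Zr ∧ (δ q Zr).2.2 ≠ Dir.R

/-- A configuration of an LBA: the current state, the head position,
and the tape contents. -/
abbrev LBACfg (Q V : Type*) := Q × ℕ × (ℕ → V)

/-- The one-step transition function of an LBA on configurations. -/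
def lbaStep {Q V : Type*} (A : LBA Q V) (c : LBACfg Q V) : LBACfg Q V :=
  ((A.δ c.1 (c.2.2 c.2.1)).1,
   movePos (A.δ c.1 (c.2.2 c.2.1)).2.2 c.2.1,
   Function.update c.2.2 c.2.1 (A.δ c.1 (c.2.2 c.2.1)).2.1)

/-- The symbols of the simulating Boolean P system: `A_{v,j} = inl (v, j)`
encodes that cell `j` contains `v`, and `C_{q,j} = inr (q, j)` encodes that
the head is on cell `j` in state `q`. -/
abbrev LSym (Q V : Type*) := (V × ℕ) ⊕ (Q × ℕ)

/-- The rules `R = ⋃_{ρ∈δ} R_ρ` of the Boolean P system simulating an LBA on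
inputs of length `n`: for each instruction `ρ = (q, X; p, Y, D)` and each cell
index `j` in the range determined by `D` (`0 ≤ j ≤ n` for `R`, `0 ≤ j ≤ n+1`
for `S`, `1 ≤ j ≤ n+1` for `L`), the rule
`{A_{X,j}, C_{q,j}} → {A_{Y,j}, C_{p, movePos D j}} | ⊤`. -/
def lbaRules {Q V : Type*} (A : LBA Q V) (n : ℕ) : Set (BRule (LSym Q V)) :=
  {r | ∃ (q : Q) (X : V) (j : ℕ),
    (match (A.δ q X).2.2 with
     | Dir.R => j ≤ n
     | Dir.S => j ≤ n + 1
     | Dir.L => 1 ≤ j ∧ j ≤ n + 1) ∧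
    r = ⟨{Sum.inl (X, j), Sum.inr (q, j)},
         {Sum.inl ((A.δ q X).2.1, j),
          Sum.inr ((A.δ q X).1, movePos (A.δ q X).2.2 j)},
         fun _ => True⟩}

/-- The initial tape `Z_l x Z_r` (cells outside `0..n+1` are blank). -/
def initTape {Q V : Type*} (A : LBA Q V) (n : ℕ) (x : Fin n → V) : ℕ → V :=
  fun j => if j = 0 then A.Zl else if j = n + 1 then A.Zr
    else if h : 1 ≤ j ∧ j ≤ n then x ⟨j - 1, by omega⟩ else A.B

/-- The all-blank tape `Z_l B^n Z_r`. -/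
def blankTape {Q V : Type*} (A : LBA Q V) (n : ℕ) : ℕ → V :=
  fun j => if j = 0 then A.Zl else if j = n + 1 then A.Zr else A.B

/-- `𝓜` accepts `x` iff starting from `Z_l q₀ x Z_r` it reaches the
configuration `Z_l q₁ B^n Z_r` with the head on cell 0. -/
def lbaAccepts {Q V : Type*} (A : LBA Q V) (n : ℕ) (x : Fin n → V) : Prop :=
  ∃ k, (lbaStep A)^[k] (A.q0, 1, initTape A n x) = (A.q1, 0, blankTape A n)

/-- The initial configuration `s_x = { A_{v_j,j} | 1 ≤ j ≤ n } ∪ { A_{Z_l,0}, A_{Z_r,n+1}, C_{q₀,1} }`. -/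
def sxCfg {Q V : Type*} (A : LBA Q V) (n : ℕ) (x : Fin n → V) : Set (LSym Q V) :=
  {Sum.inl (A.Zl, 0), Sum.inl (A.Zr, n + 1), Sum.inr (A.q0, 1)} ∪
  {s | ∃ j : Fin n, s = Sum.inl (x j, (j : ℕ) + 1)}

/-- The target configuration `{ A_{B,j} | 1 ≤ j ≤ n } ∪ { C_{q₁,0}, A_{Z_l,0}, A_{Z_r,n+1} }`. -/
def targetCfg {Q V : Type*} (A : LBA Q V) (n : ℕ) : Set (LSym Q V) :=
  {Sum.inl (A.Zl, 0), Sum.inl (A.Zr, n + 1), Sum.inr (A.q1, 0)} ∪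
  {s | ∃ j : ℕ, 1 ≤ j ∧ j ≤ n ∧ s = Sum.inl (A.B, j)}

def encCfg {Q V : Type*} (n : ℕ) (c : LBACfg Q V) : Set (LSym Q V) :=
  {s | (∃ i, i ≤ n + 1 ∧ s = Sum.inl (c.2.2 i, i)) ∨ s = Sum.inr (c.1, c.2.1)}

def goodCfg {Q V : Type*} (A : LBA Q V) (n : ℕ) (c : LBACfg Q V) : Prop :=
  c.2.1 ≤ n + 1 ∧ c.2.2 0 = A.Zl ∧ c.2.2 (n + 1) = A.Zr ∧ ∀ i, n + 1 < i → c.2.2 i = A.B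

theorem good_range {Q V : Type*} (A : LBA Q V) (n : ℕ) (c : LBACfg Q V)
    (h : goodCfg A n c) :
    (match (A.δ c.1 (c.2.2 c.2.1)).2.2 with
     | Dir.R => c.2.1 ≤ n
     | Dir.S => c.2.1 ≤ n + 1
     | Dir.L => 1 ≤ c.2.1 ∧ c.2.1 ≤ n + 1) := by
  obtain ⟨q, j, t⟩ := c
  obtain ⟨h1, h2, h3, h4⟩ := h
  dsimp only at *
  have hl := (A.hZl q).2
  have hr := (A.hZr q).2
  split
  · rename_i he
    by_contra hc
    have : j = n + 1 := by omega
    subst this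
    rw [h3] at he; exact hr he
  · exact h1
  · rename_i he
    refine ⟨?_, h1⟩
    by_contra hc
    have : j = 0 := by omega
    subst this
    rw [h2] at he; exact hl he

theorem good_step {Q V : Type*} (A : LBA Q V) (n : ℕ) (c : LBACfg Q V)
    (h : goodCfg A n c) : goodCfg A n (lbaStep A c) := by
  have hrange := good_range A n c h
  obtain ⟨q, j, t⟩ := c
  obtain ⟨h1, h2, h3, h4⟩ := h
  have hl := (A.hZl q).1
  have hr := (A.hZr q).1
  simp only [goodCfg, lbaStep] at *
  refine ⟨?_, ?_, ?_, ?_⟩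
  · cases hd : (A.δ q (t j)).2.2 <;> simp only [hd] at hrange <;> simp only [movePos] <;> omega
  · by_cases hj : j = 0
    · subst hj; simp [h2, hl]
    · rw [Function.update_of_ne (by omega)]; exact h2
  · by_cases hj : j = n + 1
    · subst hj; simp [h3, hr]
    · rw [Function.update_of_ne (by omega)]; exact h3
  · intro i hi
    rw [Function.update_of_ne (by omega)]; exact h4 i hi

theorem enc_step {Q V : Type*} (A : LBA Q V) (n : ℕ) (c : LBACfg Q V)
    (h : goodCfg A n c) :
    applyAppl (lbaRules A n) (encCfg n c) = encCfg n (lbaStep A c) := by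
  have hrange := good_range A n c h
  obtain ⟨q, j, t⟩ := c
  obtain ⟨h1, h2, h3, h4⟩ := h
  dsimp only at *
  have key : {r ∈ lbaRules A n | r.applicable (encCfg n (q, j, t))} =
      {⟨{Sum.inl (t j, j), Sum.inr (q, j)},
         {Sum.inl ((A.δ q (t j)).2.1, j),
          Sum.inr ((A.δ q (t j)).1, movePos (A.δ q (t j)).2.2 j)},
         fun _ => True⟩} := by
    ext r
    simp only [Set.mem_setOf_eq, Set.mem_singleton_iff]
    constructor
    · rintro ⟨⟨q', X, j', -, rfl⟩, hs, -⟩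
      have ha := hs (Set.mem_insert _ _)
      have hb := hs (Set.mem_insert_of_mem _ (Set.mem_singleton _))
      simp [encCfg] at ha hb
      obtain ⟨rfl, rfl⟩ := hb
      obtain ⟨-, rfl⟩ := ha
      rfl
    · rintro rfl
      refine ⟨⟨q, t j, j, hrange, rfl⟩, ?_, trivial⟩
      intro s hs
      rcases hs with rfl | rfl
      · exact Or.inl ⟨j, h1, rfl⟩
      · exact Or.inr rfl
  unfold applyAppl
  rw [key]
  ext s
  simp only [applyRules, Set.mem_singleton_iff, Set.iUnion_iUnion_eq_left]
  rcases s with ⟨v, i⟩ | ⟨p, i⟩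
  · by_cases hij : i = j
    · subst hij
      simp [encCfg, lbaStep]
      grind
    · simp [encCfg, lbaStep, hij, Function.update_of_ne hij]
  · simp [encCfg, lbaStep]

theorem enc_inj {Q V : Type*} (A : LBA Q V) (n : ℕ) (c d : LBACfg Q V)
    (hc : goodCfg A n c) (hd : goodCfg A n d) (h : encCfg n c = encCfg n d) : c = d := by
  obtain ⟨q, j, t⟩ := c
  obtain ⟨q', j', t'⟩ := d
  have h1 : (Sum.inr (q, j) : LSym Q V) ∈ encCfg n (q', j', t') := by
    rw [← h]; exact Or.inr rfl
  have h2 : ∀ i, i ≤ n + 1 → (Sum.inl (t i, i) : LSym Q V) ∈ encCfg n (q', j', t') := by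
    intro i hi; rw [← h]; exact Or.inl ⟨i, hi, rfl⟩
  simp [encCfg] at h1 h2
  obtain ⟨rfl, rfl⟩ := h1
  have : t = t' := by
    funext i
    by_cases hi : i ≤ n + 1
    · exact (h2 i hi).2
    · exact (hc.2.2.2 i (by omega)).trans (hd.2.2.2 i (by omega)).symm
  rw [this]

theorem enc_init {Q V : Type*} (A : LBA Q V) (n : ℕ) (x : Fin n → V) :
    sxCfg A n x = encCfg n (A.q0, 1, initTape A n x) := by
  ext s
  rcases s with ⟨v, i⟩ | ⟨p, i⟩
  · simp only [sxCfg, encCfg, initTape, Set.mem_union, Set.mem_insert_iff,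
      Set.mem_singleton_iff, Set.mem_setOf_eq, Sum.inl.injEq, Prod.mk.injEq, reduceCtorEq, or_false]
    constructor
    · rintro ((⟨rfl, rfl⟩ | ⟨rfl, rfl⟩) | ⟨j, rfl, rfl⟩)
      · exact ⟨0, by simp⟩
      · exact ⟨n + 1, by simp⟩
      · refine ⟨j + 1, by omega, ?_, rfl⟩
        have := j.2
        simp [this.ne]
    · rintro ⟨k, hk, hv, rfl⟩
      by_cases h0 : i = 0
      · subst h0; left; left; simpa using hv
      by_cases h1 : i = n + 1
      · subst h1; left; right; simpa using hv
      right
      have h2 : 1 ≤ i ∧ i ≤ n := by omega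
      refine ⟨⟨i - 1, by omega⟩, ?_, by simp; omega⟩
      simpa [h0, h1, h2] using hv
  · simp [sxCfg, encCfg]

theorem enc_target {Q V : Type*} (A : LBA Q V) (n : ℕ) :
    targetCfg A n = encCfg n (A.q1, 0, blankTape A n) := by
  ext s
  rcases s with ⟨v, i⟩ | ⟨p, i⟩
  · simp only [targetCfg, encCfg, blankTape, Set.mem_union, Set.mem_insert_iff,
      Set.mem_singleton_iff, Set.mem_setOf_eq, Sum.inl.injEq, Prod.mk.injEq, reduceCtorEq, or_false]
    constructor
    · rintro ((⟨rfl, rfl⟩ | ⟨rfl, rfl⟩) | ⟨j, hj1, hj2, rfl, rfl⟩)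
      · exact ⟨0, by simp⟩
      · exact ⟨n + 1, by simp⟩
      · refine ⟨i, by omega, ?_, rfl⟩
        rw [if_neg (by omega), if_neg (by omega)]
    · rintro ⟨k, hk, hv, rfl⟩
      by_cases h0 : i = 0
      · subst h0; left; left; simpa using hv
      by_cases h1 : i = n + 1
      · subst h1; left; right; simpa using hv
      right
      exact ⟨i, by omega, by omega, by simpa [h0, h1] using hv, rfl⟩
  · simp [targetCfg, encCfg]

theorem good_init {Q V : Type*} (A : LBA Q V) (n : ℕ) (x : Fin n → V) :
    goodCfg A n (A.q0, 1, initTape A n x) := by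
  refine ⟨by simp, by simp [initTape], by simp [initTape], ?_⟩
  intro i hi
  dsimp only [initTape]
  rw [if_neg (by omega), if_neg (by omega), dif_neg (by omega)]

theorem good_target {Q V : Type*} (A : LBA Q V) (n : ℕ) :
    goodCfg A n (A.q1, 0, blankTape A n) := by
  refine ⟨by simp, by simp [blankTape], by simp [blankTape], ?_⟩
  intro i hi
  dsimp only [blankTape]
  rw [if_neg (by omega), if_neg (by omega)]

theorem good_iter {Q V : Type*} (A : LBA Q V) (n : ℕ) (c : LBACfg Q V)
    (h : goodCfg A n c) (k : ℕ) : goodCfg A n ((lbaStep A)^[k] c) := by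
  induction k with
  | zero => exact h
  | succ k ih => rw [Function.iterate_succ_apply']; exact good_step A n _ ih

/-- the LBA `𝓜` accepts the input `x ∈ T₁*` of length `n` iff the
Boolean P system `Π = (Ṽ, R)`, evolving under the quasimode `M̃ = {R}` from the
initial configuration `s_x`, can reach the target configuration. -/
theorem stmt8 {Q V : Type*} [Finite Q] [Finite V]
    (A : LBA Q V) (n : ℕ) (x : Fin n → V) (hx : ∀ i, x i ∈ A.T1) :
    lbaAccepts A n x ↔
      ∃ (k : ℕ) (Wseq : ℕ → Set (LSym Q V)),
        Wseq 0 = sxCfg A n x ∧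
        (∀ i < k, QStep {lbaRules A n} (Wseq i) (Wseq (i + 1))) ∧
        Wseq k = targetCfg A n := by
  have hg := good_iter A n _ (good_init A n x)
  constructor
  · rintro ⟨k, hk⟩
    refine ⟨k, fun i => encCfg n ((lbaStep A)^[i] (A.q0, 1, initTape A n x)),
      (enc_init A n x).symm, ?_, ?_⟩
    · intro i _
      refine ⟨_, rfl, ?_⟩
      dsimp only
      rw [enc_step A n _ (hg i), Function.iterate_succ_apply']
    · dsimp only
      rw [hk, enc_target]
  · rintro ⟨k, W, h0, hs, hk⟩
    refine ⟨k, ?_⟩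
    have hW : ∀ i, i ≤ k → W i = encCfg n ((lbaStep A)^[i] (A.q0, 1, initTape A n x)) := by
      intro i
      induction i with
      | zero => intro _; rw [h0, enc_init]; rfl
      | succ i ih =>
        intro hi
        obtain ⟨m, hm, he⟩ := hs i (by omega)
        rw [Set.mem_singleton_iff] at hm
        subst hm
        rw [he, ih (by omega), enc_step A n _ (hg i), Function.iterate_succ_apply']
    apply enc_inj A n _ _ (hg k) (good_target A n)
    rw [← hW k le_rfl, hk, enc_target]
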